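/- arXiv:2102.09599 — 3 statements merged into one kernel-verified Lean document; each statement's English description precedes it below -/
import Mathlib

section
/- Let m ≥ 2, d ≥ 1, k > 0, 0 < η with m·η ≤ 1, 0 < τ < 1, b ≥ 0, and L ≥ 0. Let f : ℝ^d → ℝ^m be L-Lipschitz with respect to the Euclidean norms, with f(X) ∈ Δ_{m,η} for every X ∈ ℝ^d. Then for all X, X' ∈ ℝ^d with ‖X − X'‖₂ ≤ b and every z ∈ Δ_{m,τ}, the Dirichlet densities satisfy log p_k(f(X), z) ≤ log p_k(f(X'), z) + √m·L·b·k·log(1/τ) + (m−1)·log Γ(k·η) + log Γ(k·(1−(m−1)·η)) − m·log Γ(k/m). -/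
noncomputable section

/-- The η-restricted simplex Δ_{m,η} ⊆ ℝ^m. -/
def restrictedSimplex (m : ℕ) (η : ℝ) : Set (EuclideanSpace ℝ (Fin m)) :=
  {x | (∑ i, x i) = 1 ∧ ∀ i, η ≤ x i}

/-- The Dirichlet density p_k(p, z) = Γ(k) · ∏ z_i^{k·p_i − 1} / Γ(k·p_i). -/
def dirichletDensity (m : ℕ) (k : ℝ) (p z : EuclideanSpace ℝ (Fin m)) : ℝ :=
  Real.Gamma k * ∏ i, (z i) ^ (k * p i - 1) / Real.Gamma (k * p i)

theorem aux_log_density (m : ℕ) (k : ℝ) (hk : 0 < k) (p z : EuclideanSpace ℝ (Fin m))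
    (hp : ∀ i, 0 < p i) (hz : ∀ i, 0 < z i) :
    Real.log (dirichletDensity m k p z) = Real.log (Real.Gamma k) +
      ∑ i, ((k * p i - 1) * Real.log (z i) - Real.log (Real.Gamma (k * p i))) := by
  have hG : ∀ i, 0 < Real.Gamma (k * p i) := fun i => Real.Gamma_pos_of_pos (mul_pos hk (hp i))
  have hterm : ∀ i, 0 < (z i) ^ (k * p i - 1) / Real.Gamma (k * p i) := fun i =>
    div_pos (Real.rpow_pos_of_pos (hz i) _) (hG i)
  unfold dirichletDensity
  rw [Real.log_mul (Real.Gamma_pos_of_pos hk).ne' (Finset.prod_pos fun i _ => hterm i).ne',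
    Real.log_prod (fun i _ => (hterm i).ne')]
  congr 1
  refine Finset.sum_congr rfl fun i _ => ?_
  rw [Real.log_div (Real.rpow_pos_of_pos (hz i) _).ne' (hG i).ne', Real.log_rpow (hz i)]

theorem aux_lower (m : ℕ) (hm : 2 ≤ m) (k : ℝ) (hk : 0 < k) (x : Fin m → ℝ)
    (hx : ∀ i, 0 < x i) (hs : ∑ i, x i = 1) :
    (m : ℝ) * Real.log (Real.Gamma (k / m)) ≤ ∑ i, Real.log (Real.Gamma (k * x i)) := by
  have hm0 : (0 : ℝ) < m := by exact_mod_cast (by omega : 0 < m)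
  have h := Real.convexOn_log_Gamma.map_sum_le (t := Finset.univ) (w := fun _ : Fin m => (1 / m : ℝ))
    (p := fun i => k * x i) (fun i _ => by positivity)
    (by simp [hm0.ne']) (fun i _ => mul_pos hk (hx i))
  simp only [smul_eq_mul, Function.comp, ← Finset.mul_sum, hs] at h
  have e : 1 / (m : ℝ) * (k * 1) = k / m := by ring
  rw [e] at h
  calc _ ≤ (m : ℝ) * (1 / m * ∑ i, Real.log (Real.Gamma (k * x i))) := by gcongr
    _ = _ := by field_simp

theorem aux_upper (m : ℕ) (k : ℝ) (hk : 0 < k) (η : ℝ) (hη : 0 < η)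
    (hmη : (m : ℝ) * η ≤ 1) (x : Fin m → ℝ)
    (hx : ∀ i, η ≤ x i) (hs : ∑ i, x i = 1) :
    ∑ i, Real.log (Real.Gamma (k * x i)) ≤ ((m : ℝ) - 1) * Real.log (Real.Gamma (k * η))
            + Real.log (Real.Gamma (k * (1 - ((m : ℝ) - 1) * η))) := by
  have hsum : ∑ i, (x i - η) = 1 - m * η := by simp [Finset.sum_sub_distrib, hs]
  rcases hmη.lt_or_eq with h1 | h1
  · have hD : 0 < 1 - m * η := by linarith
    have hle : ∀ i, x i - η ≤ 1 - m * η := fun i => by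
      rw [← hsum]
      exact Finset.single_le_sum (f := fun i => x i - η)
        (fun j _ => sub_nonneg.2 (hx j)) (Finset.mem_univ i)
    have key : ∀ i, Real.log (Real.Gamma (k * x i)) ≤
        (1 - (x i - η) / (1 - m * η)) * Real.log (Real.Gamma (k * η)) +
        ((x i - η) / (1 - m * η)) * Real.log (Real.Gamma (k * (1 - ((m : ℝ) - 1) * η))) := by
      intro i
      have hM : 0 < 1 - ((m : ℝ) - 1) * η := by linarith
      have hkη : k * η ∈ Set.Ioi (0 : ℝ) := mul_pos hk hη
      have hkM : k * (1 - ((m : ℝ) - 1) * η) ∈ Set.Ioi (0 : ℝ) := mul_pos hk hM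
      have ha : 0 ≤ 1 - (x i - η) / (1 - m * η) := sub_nonneg.2 ((div_le_one hD).2 (hle i))
      have hb : 0 ≤ (x i - η) / (1 - m * η) := div_nonneg (sub_nonneg.2 (hx i)) hD.le
      have h := Real.convexOn_log_Gamma.2 hkη hkM ha hb (by ring)
      simp only [smul_eq_mul, Function.comp] at h
      have e : (1 - (x i - η) / (1 - m * η)) * (k * η) +
          (x i - η) / (1 - m * η) * (k * (1 - ((m : ℝ) - 1) * η)) = k * x i := by
        have hq : (x i - η) / (1 - m * η) * (1 - m * η) = x i - η := div_mul_cancel₀ _ hD.ne'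
        linear_combination k * hq
      rwa [e] at h
    refine (Finset.sum_le_sum fun i _ => key i).trans_eq ?_
    rw [Finset.sum_add_distrib, ← Finset.sum_mul, ← Finset.sum_mul, Finset.sum_sub_distrib,
      ← Finset.sum_div, hsum, div_self hD.ne']
    simp
  · have h0 : ∀ i, x i = η := by
      have := (Finset.sum_eq_zero_iff_of_nonneg (s := Finset.univ) (f := fun i => x i - η)
        (fun j _ => sub_nonneg.2 (hx j))).1 (by rw [hsum, h1]; ring)
      intro i
      have := this i (Finset.mem_univ i)
      linarith
    have e : 1 - ((m : ℝ) - 1) * η = η := by linarith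
    simp only [h0, e]
    simp only [Finset.sum_const, Finset.card_univ, Fintype.card_fin, nsmul_eq_mul]
    linarith

theorem aux_l1 (m : ℕ) (v : EuclideanSpace ℝ (Fin m)) :
    ∑ i, |v i| ≤ Real.sqrt m * ‖v‖ := by
  rw [EuclideanSpace.norm_eq, ← Real.sqrt_mul (by positivity)]
  apply Real.le_sqrt_of_sq_le
  have := sq_sum_le_card_mul_sum_sq (s := Finset.univ) (f := fun i => |v i|)
  simpa using this

/-- log-ratio bound on Dirichlet densities for policies produced by an
L-Lipschitz map f into Δ_{m,η} at b-adjacent inputs, evaluated at points of Δ_{m,τ}. -/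
theorem dirichlet_density_log_ratio_bound_composed
    (m d : ℕ) (hm : 2 ≤ m) (hd : 1 ≤ d) (k : ℝ) (hk : 0 < k)
    (η : ℝ) (hη : 0 < η) (hmη : (m : ℝ) * η ≤ 1)
    (τ : ℝ) (hτ0 : 0 < τ) (hτ1 : τ < 1)
    (b L : ℝ) (hb : 0 ≤ b) (hL : 0 ≤ L)
    (f : EuclideanSpace ℝ (Fin d) → EuclideanSpace ℝ (Fin m))
    (hfLip : ∀ X Y, ‖f X - f Y‖ ≤ L * ‖X - Y‖)
    (hfmem : ∀ X, f X ∈ restrictedSimplex m η) :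
    ∀ X X' : EuclideanSpace ℝ (Fin d), ‖X - X'‖ ≤ b →
      ∀ z ∈ restrictedSimplex m τ,
        Real.log (dirichletDensity m k (f X) z) ≤
          Real.log (dirichletDensity m k (f X') z)
            + Real.sqrt m * L * b * k * Real.log (1 / τ)
            + ((m : ℝ) - 1) * Real.log (Real.Gamma (k * η))
            + Real.log (Real.Gamma (k * (1 - ((m : ℝ) - 1) * η)))
            - (m : ℝ) * Real.log (Real.Gamma (k / m)) := by
  intro X X' hXX z hz
  obtain ⟨hz1, hzτ⟩ := hz
  obtain ⟨hx1, hxη⟩ := hfmem X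
  obtain ⟨hy1, hyη⟩ := hfmem X'
  have hz0 : ∀ i, 0 < z i := fun i => hτ0.trans_le (hzτ i)
  have hx0 : ∀ i, 0 < f X i := fun i => hη.trans_le (hxη i)
  have hy0 : ∀ i, 0 < f X' i := fun i => hη.trans_le (hyη i)
  rw [aux_log_density m k hk _ z hx0 hz0, aux_log_density m k hk _ z hy0 hz0]
  have hlo := aux_lower m hm k hk (fun i => f X i) hx0 hx1
  have hup := aux_upper m k hk η hη hmη (fun i => f X' i) hyη hy1
  have hlogτ : 0 ≤ Real.log (1 / τ) := Real.log_nonneg (by rw [le_div_iff₀ hτ0]; linarith)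
  have hzle : ∀ i, z i ≤ 1 := fun i => by
    rw [← hz1]
    exact Finset.single_le_sum (f := fun i => z i) (fun j _ => (hz0 j).le) (Finset.mem_univ i)
  have hterm : ∀ i, (f X i - f X' i) * Real.log (z i) ≤ |(f X - f X') i| * Real.log (1 / τ) := by
    intro i
    refine (le_abs_self _).trans ?_
    rw [abs_mul]
    refine mul_le_mul (le_of_eq (by simp)) ?_ (abs_nonneg _) (abs_nonneg _)
    rw [abs_of_nonpos (Real.log_nonpos (hz0 i).le (hzle i)), one_div, Real.log_inv]
    exact neg_le_neg (Real.log_le_log hτ0 (hzτ i))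
  have hA : ∑ i, (f X i - f X' i) * Real.log (z i) ≤ Real.sqrt m * (L * b) * Real.log (1 / τ) := by
    refine (Finset.sum_le_sum fun i _ => hterm i).trans ?_
    rw [← Finset.sum_mul]
    refine mul_le_mul_of_nonneg_right ((aux_l1 m _).trans ?_) hlogτ
    refine mul_le_mul_of_nonneg_left ((hfLip X X').trans ?_) (Real.sqrt_nonneg _)
    exact mul_le_mul_of_nonneg_left hXX hL
  have hA' := mul_le_mul_of_nonneg_left hA hk.le
  have e : k * ∑ i, (f X i - f X' i) * Real.log (z i) =
      ∑ i, (k * f X i - 1) * Real.log (z i) - ∑ i, (k * f X' i - 1) * Real.log (z i) := by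
    rw [Finset.mul_sum, ← Finset.sum_sub_distrib]
    exact Finset.sum_congr rfl fun i _ => by ring
  rw [Finset.sum_sub_distrib, Finset.sum_sub_distrib]
  have e2 : k * (Real.sqrt m * (L * b) * Real.log (1 / τ)) =
    Real.sqrt m * L * b * k * Real.log (1 / τ) := by ring
  rw [e, e2] at hA'
  linarith

end
end

section
/- Let m ≥ 2, k > 0, 0 < η with m·η ≤ 1, 0 < τ < 1, and b ≥ 0. Set ε₀ := √m·b·k·log(1/τ) + (m−1)·log Γ(k·η) + log Γ(k·(1−(m−1)·η)) − m·log Γ(k/m). Then for all π, π' ∈ Δ_{m,η} with ‖π − π'‖₂ ≤ b and every Borel set S ⊆ S_τ, one has μ_{k,π}(S) ≤ exp(ε₀)·μ_{k,π'}(S). -/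
open MeasureTheory

noncomputable section

/-- The open set T = {x ∈ ℝ^{m-1} : x_i > 0, ∑ x_i < 1} (here with m = n+1). -/
def simplexInterior (n : ℕ) : Set (EuclideanSpace ℝ (Fin n)) :=
  {x | (∀ i, 0 < x i) ∧ (∑ i, x i) < 1}

/-- The Dirichlet mechanism Dir_k(p), expressed as a measure μ_{k,p} on the first
m−1 coordinates (here m = n+1). -/
def dirichletMeasure (n : ℕ) (k : ℝ) (p : EuclideanSpace ℝ (Fin (n+1))) :
    Measure (EuclideanSpace ℝ (Fin n)) :=
  (volume.restrict (simplexInterior n)).withDensity fun x =>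
    ENNReal.ofReal (Real.Gamma k *
      (∏ i : Fin n, (x i) ^ (k * p i.castSucc - 1)) *
      (1 - ∑ i, x i) ^ (k * p (Fin.last n) - 1) /
      ∏ i, Real.Gamma (k * p i))

/-- The coordinate representation S_τ ⊆ ℝ^{m-1} of Δ_{m,τ} (here m = n+1). -/
def restrictedSimplexCoord (n : ℕ) (τ : ℝ) : Set (EuclideanSpace ℝ (Fin n)) :=
  {x ∈ simplexInterior n | (∀ i, τ ≤ x i) ∧ τ ≤ 1 - ∑ i, x i}

lemma logGamma_sum_upper (n : ℕ) (k : ℝ) (hk : 0 < k) (η : ℝ) (hη : 0 < η)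
    (hmη : ((n : ℝ) + 1) * η ≤ 1) (p : Fin (n+1) → ℝ) (hs : ∑ i, p i = 1) (hp : ∀ i, η ≤ p i) :
    ∑ i, Real.log (Real.Gamma (k * p i)) ≤
      (n : ℝ) * Real.log (Real.Gamma (k * η)) + Real.log (Real.Gamma (k * (1 - (n : ℝ) * η))) := by
  have hn1 : (0 : ℝ) < (n : ℝ) + 1 := by positivity
  obtain ⟨t, ht0, ht1, hpt⟩ : ∃ t : Fin (n+1) → ℝ, (∀ i, 0 ≤ t i) ∧ ∑ i, t i = 1 ∧
      ∀ i, p i = (1 - t i) * η + t i * (1 - n * η) := by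
    rcases eq_or_lt_of_le hmη with h | h
    · refine ⟨fun _ => 1 / ((n : ℝ) + 1), fun _ => by positivity, ?_, ?_⟩
      · simp
        field_simp
      · have h0 : ∑ i, (p i - η) = 0 := by
          rw [Finset.sum_sub_distrib, hs]; simp; linarith
        have h1 := (Finset.sum_eq_zero_iff_of_nonneg
          (fun i _ => sub_nonneg.2 (hp i))).1 h0
        intro i
        have h2 := h1 i (Finset.mem_univ i)
        have h3 : 1 - n * η = η := by linarith
        rw [h3]; linarith
    · have hd : 0 < 1 - ((n : ℝ) + 1) * η := by linarith
      refine ⟨fun i => (p i - η) / (1 - ((n : ℝ) + 1) * η),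
        fun i => div_nonneg (sub_nonneg.2 (hp i)) hd.le, ?_, ?_⟩
      · rw [← Finset.sum_div, Finset.sum_sub_distrib, hs]
        rw [div_eq_one_iff_eq hd.ne']
        simp
      · intro i
        have h2 : (p i - η) / (1 - ((n : ℝ) + 1) * η) * (1 - ((n : ℝ) + 1) * η) = p i - η :=
          div_mul_cancel₀ _ hd.ne'
        linear_combination -h2
  have hti : ∀ i, t i ≤ 1 := fun i => by
    rw [← ht1]; exact Finset.single_le_sum (fun j _ => ht0 j) (Finset.mem_univ i)
  have hpos : 0 < 1 - (n : ℝ) * η := by nlinarith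
  have key : ∀ i, Real.log (Real.Gamma (k * p i)) ≤
      (1 - t i) * Real.log (Real.Gamma (k * η)) +
        t i * Real.log (Real.Gamma (k * (1 - (n : ℝ) * η))) := by
    intro i
    have := Real.convexOn_log_Gamma.2 (Set.mem_Ioi.2 (show 0 < k * η by positivity))
      (Set.mem_Ioi.2 (show 0 < k * (1 - n * η) by positivity))
      (show 0 ≤ 1 - t i by linarith [hti i]) (ht0 i) (by ring)
    simp only [smul_eq_mul, Function.comp] at this
    have e : k * p i = (1 - t i) * (k * η) + t i * (k * (1 - n * η)) := by
      rw [hpt i]; ring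
    rw [e]; exact this
  refine (Finset.sum_le_sum fun i _ => key i).trans (le_of_eq ?_)
  rw [Finset.sum_add_distrib, ← Finset.sum_mul, ← Finset.sum_mul, Finset.sum_sub_distrib, ht1]
  simp

lemma logGamma_sum_lower (n : ℕ) (k : ℝ) (hk : 0 < k)
    (p : Fin (n+1) → ℝ) (hs : ∑ i, p i = 1) (hp : ∀ i, 0 < p i) :
    ((n : ℝ) + 1) * Real.log (Real.Gamma (k / ((n : ℝ) + 1))) ≤
      ∑ i, Real.log (Real.Gamma (k * p i)) := by
  have hn1 : (0 : ℝ) < (n : ℝ) + 1 := by positivity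
  have := Real.convexOn_log_Gamma.map_sum_le (t := Finset.univ)
    (w := fun _ : Fin (n+1) => 1 / ((n : ℝ) + 1)) (p := fun i => k * p i)
    (fun _ _ => by positivity) (by simp; field_simp)
    (fun i _ => Set.mem_Ioi.2 (mul_pos hk (hp i)))
  simp only [smul_eq_mul, Function.comp, ← Finset.mul_sum, hs] at this
  have e : 1 / ((n : ℝ) + 1) * (k * 1) = k / ((n : ℝ) + 1) := by ring
  rw [e, one_div, ← div_eq_inv_mul, le_div_iff₀ hn1] at this
  linarith

lemma dens_eq (n : ℕ) (k : ℝ) (hk : 0 < k) (p : EuclideanSpace ℝ (Fin (n+1)))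
    (hp : ∀ i, 0 < p i) (x : EuclideanSpace ℝ (Fin n)) (y : Fin (n+1) → ℝ)
    (hy : ∀ i, 0 < y i) (hyx : ∀ i : Fin n, y i.castSucc = x i)
    (hyl : y (Fin.last n) = 1 - ∑ i, x i) :
    Real.Gamma k * (∏ i : Fin n, (x i) ^ (k * p i.castSucc - 1)) *
      (1 - ∑ i, x i) ^ (k * p (Fin.last n) - 1) / ∏ i, Real.Gamma (k * p i) =
    Real.Gamma k * Real.exp (∑ i, ((k * p i - 1) * Real.log (y i)) -
      ∑ i, Real.log (Real.Gamma (k * p i))) := by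
  rw [Real.exp_sub, Real.exp_sum, Real.exp_sum, ← mul_div_assoc, mul_assoc]
  have hG : ∏ i, Real.exp (Real.log (Real.Gamma (k * p i))) = ∏ i, Real.Gamma (k * p i) :=
    Finset.prod_congr rfl fun i _ =>
      Real.exp_log (Real.Gamma_pos_of_pos (mul_pos hk (hp i)))
  rw [hG]
  congr 2
  · rw [Fin.prod_univ_castSucc]
    rw [← hyl]
    simp only [← hyx]
    congr 1
    · refine Finset.prod_congr rfl fun i _ => ?_
      rw [Real.rpow_def_of_pos (hy _), mul_comm]
    · rw [Real.rpow_def_of_pos (hy _), mul_comm]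

lemma l1_bound (n : ℕ) (b : ℝ) (q : EuclideanSpace ℝ (Fin (n+1))) (hq : ‖q‖ ≤ b) :
    ∑ i, |q i| ≤ Real.sqrt ((n : ℝ) + 1) * b := by
  have h := sq_sum_le_card_mul_sum_sq (s := Finset.univ) (f := fun i => |q i|)
  have h2 := EuclideanSpace.real_norm_sq_eq q
  simp only [sq_abs, ← h2] at h
  simp at h
  have h3 : ∑ i, |q i| ≤ Real.sqrt ((n : ℝ) + 1) * ‖q‖ := by
    refine abs_le_of_sq_le_sq' ?_ (by positivity) |>.2
    rw [mul_pow, Real.sq_sqrt (by positivity)]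
    exact h
  exact h3.trans (by gcongr)

/-- for π, π' ∈ Δ_{m,η} with ‖π − π'‖₂ ≤ b (m = n+1) and every Borel
S ⊆ S_τ, μ_{k,π}(S) ≤ exp(ε₀)·μ_{k,π'}(S) with
ε₀ = √m·b·k·log(1/τ) + (m−1)·log Γ(kη) + log Γ(k(1−(m−1)η)) − m·log Γ(k/m). -/
theorem dirichlet_mechanism_pure_dp_on_restricted_simplex
    (n : ℕ) (hn : 1 ≤ n) (k : ℝ) (hk : 0 < k)
    (η : ℝ) (hη : 0 < η) (hmη : ((n : ℝ) + 1) * η ≤ 1)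
    (τ : ℝ) (hτ0 : 0 < τ) (hτ1 : τ < 1)
    (b : ℝ) (hb : 0 ≤ b) :
    ∀ p ∈ restrictedSimplex (n+1) η, ∀ p' ∈ restrictedSimplex (n+1) η, ‖p - p'‖ ≤ b →
      ∀ S : Set (EuclideanSpace ℝ (Fin n)), MeasurableSet S → S ⊆ restrictedSimplexCoord n τ →
        dirichletMeasure n k p S ≤
          ENNReal.ofReal (Real.exp
              (Real.sqrt ((n : ℝ) + 1) * b * k * Real.log (1 / τ)
                + (n : ℝ) * Real.log (Real.Gamma (k * η))
                + Real.log (Real.Gamma (k * (1 - (n : ℝ) * η)))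
                - ((n : ℝ) + 1) * Real.log (Real.Gamma (k / ((n : ℝ) + 1))))) *
            dirichletMeasure n k p' S := by
  intro p hp p' hp' hpp S hS hST
  have hpos : ∀ i, 0 < p i := fun i => hη.trans_le (hp.2 i)
  have hpos' : ∀ i, 0 < p' i := fun i => hη.trans_le (hp'.2 i)
  unfold dirichletMeasure
  rw [withDensity_apply _ hS, withDensity_apply _ hS,
    ← lintegral_const_mul' _ _ ENNReal.ofReal_ne_top]
  refine setLIntegral_mono' hS fun x hx => ?_
  obtain ⟨⟨hx0, hx1⟩, hxτ, hlτ⟩ := hST hx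
  rw [← ENNReal.ofReal_mul (Real.exp_pos _).le]
  apply ENNReal.ofReal_le_ofReal
  set y : Fin (n+1) → ℝ := Fin.snoc (α := fun _ => ℝ) (fun i => x i) (1 - ∑ i, x i) with hydef
  have hyx : ∀ i : Fin n, y i.castSucc = x i := fun i => by simp [hydef]
  have hyl : y (Fin.last n) = 1 - ∑ i, x i := by simp [hydef]
  have hyτ : ∀ i, τ ≤ y i := by
    intro i
    refine Fin.lastCases ?_ (fun j => ?_) i
    · rw [hyl]; exact hlτ
    · rw [hyx]; exact hxτ j
  have hy : ∀ i, 0 < y i := fun i => hτ0.trans_le (hyτ i)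
  have hysum : ∑ i, y i = 1 := by
    rw [Fin.sum_univ_castSucc, hyl]; simp only [hyx]; ring
  have hy1 : ∀ i, y i ≤ 1 := fun i => by
    rw [← hysum]; exact Finset.single_le_sum (fun j _ => (hy j).le) (Finset.mem_univ i)
  rw [dens_eq n k hk p hpos x y hy hyx hyl, dens_eq n k hk p' hpos' x y hy hyx hyl,
    mul_left_comm, ← Real.exp_add]
  refine mul_le_mul_of_nonneg_left (Real.exp_le_exp.2 ?_) (Real.Gamma_pos_of_pos hk).le
  have hU := logGamma_sum_upper n k hk η hη hmη p' hp'.1 hp'.2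
  have hL := logGamma_sum_lower n k hk p hp.1 hpos
  have h1 := l1_bound n b (p - p') hpp
  have hlog : 0 ≤ Real.log (1 / τ) := by
    apply Real.log_nonneg
    rw [le_div_iff₀ hτ0]; linarith
  have hmain : ∑ i, ((k * p i - 1) * Real.log (y i)) - ∑ i, ((k * p' i - 1) * Real.log (y i)) ≤
      Real.sqrt ((n : ℝ) + 1) * b * k * Real.log (1 / τ) := by
    calc _ = ∑ i, k * ((p - p') i * Real.log (y i)) := by
          rw [← Finset.sum_sub_distrib]
          refine Finset.sum_congr rfl fun i _ => ?_
          simp only [PiLp.sub_apply]; ring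
      _ ≤ ∑ i, k * (|(p - p') i| * Real.log (1 / τ)) := by
          refine Finset.sum_le_sum fun i _ => mul_le_mul_of_nonneg_left ?_ hk.le
          refine (le_abs_self _).trans ?_
          rw [abs_mul]
          refine mul_le_mul_of_nonneg_left ?_ (abs_nonneg _)
          rw [abs_of_nonpos (Real.log_nonpos (hy i).le (hy1 i)), one_div, Real.log_inv]
          exact neg_le_neg (Real.log_le_log hτ0 (hyτ i))
      _ = (∑ i, |(p - p') i|) * (k * Real.log (1 / τ)) := by
          rw [Finset.sum_mul]
          exact Finset.sum_congr rfl fun i _ => by ring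
      _ ≤ Real.sqrt ((n : ℝ) + 1) * b * (k * Real.log (1 / τ)) :=
          mul_le_mul_of_nonneg_right h1 (by positivity)
      _ = _ := by ring
  linarith

end
end

section
/- Let m ≥ 1, k > 0, and 0 < η with m·η ≤ 1. Then for every π ∈ Δ_{m,η}, one has ∑_{i=1}^m log Γ(k·π_i) ≤ (m−1)·log Γ(k·η) + log Γ(k·(1−(m−1)·η)). -/
noncomputable section

/-- for π ∈ Δ_{m,η},
∑ log Γ(k·π_i) ≤ (m−1)·log Γ(k·η) + log Γ(k·(1−(m−1)·η)). -/
theorem sum_log_gamma_le_vertex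
    (m : ℕ) (hm : 1 ≤ m) (k : ℝ) (hk : 0 < k)
    (η : ℝ) (hη : 0 < η) (hmη : (m : ℝ) * η ≤ 1) :
    ∀ p ∈ restrictedSimplex m η,
      (∑ i, Real.log (Real.Gamma (k * p i))) ≤
        ((m : ℝ) - 1) * Real.log (Real.Gamma (k * η))
          + Real.log (Real.Gamma (k * (1 - ((m : ℝ) - 1) * η))) := by
  rintro p ⟨hsum, hge⟩
  have hconv := Real.convexOn_log_Gamma
  have hs : ∑ i, (p i - η) = 1 - (m : ℝ) * η := by
    rw [Finset.sum_sub_distrib, hsum]; simp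
  rcases hmη.eq_or_lt with h0 | h0
  · have hall : ∀ i, p i = η := by
      have h1 : ∑ i, (p i - η) = 0 := by rw [hs, h0]; ring
      rw [Finset.sum_eq_zero_iff_of_nonneg (fun i _ => by linarith [hge i])] at h1
      intro i
      linarith [h1 i (Finset.mem_univ i)]
    have hM : 1 - ((m : ℝ) - 1) * η = η := by linarith
    rw [hM]
    simp only [hall]
    simp only [Finset.sum_const, Finset.card_univ, Fintype.card_fin, nsmul_eq_mul]
    linarith
  · have hd : 0 < 1 - (m : ℝ) * η := by linarith
    set d := 1 - (m : ℝ) * η with hd'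
    have hM : 1 - ((m : ℝ) - 1) * η = η + d := by rw [hd']; ring
    rw [hM]
    have hts : ∑ i, (p i - η) / d = 1 := by
      rw [← Finset.sum_div, hs, div_self hd.ne']
    have ht0 : ∀ i, 0 ≤ (p i - η) / d := fun i => div_nonneg (by linarith [hge i]) hd.le
    have ht1 : ∀ i, (p i - η) / d ≤ 1 := fun i => by
      rw [← hts]
      exact Finset.single_le_sum (f := fun i => (p i - η) / d) (fun j _ => ht0 j)
        (Finset.mem_univ i)
    have key : ∀ i, Real.log (Real.Gamma (k * p i)) ≤
        Real.log (Real.Gamma (k * η)) + (p i - η) / d *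
          (Real.log (Real.Gamma (k * (η + d))) - Real.log (Real.Gamma (k * η))) := by
      intro i
      have hx : k * η ∈ Set.Ioi (0 : ℝ) := Set.mem_Ioi.2 (by positivity)
      have hy : k * (η + d) ∈ Set.Ioi (0 : ℝ) := Set.mem_Ioi.2 (by positivity)
      have ha : 0 ≤ 1 - (p i - η) / d := by linarith [ht1 i]
      have h := hconv.2 hx hy ha (ht0 i) (by ring)
      simp only [smul_eq_mul, Function.comp] at h
      have he : (1 - (p i - η) / d) * (k * η) + (p i - η) / d * (k * (η + d)) = k * p i := by
        have : (p i - η) / d * d = p i - η := div_mul_cancel₀ _ hd.ne'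
        linear_combination k * this
      rw [he] at h
      linarith
    refine (Finset.sum_le_sum fun i _ => key i).trans (le_of_eq ?_)
    rw [Finset.sum_add_distrib, ← Finset.sum_mul, hts]
    simp only [Finset.sum_const, Finset.card_univ, Fintype.card_fin, nsmul_eq_mul]
    ring

end
end
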